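/- For every f ∈ L^1(T), the (a.e.-defined radial) boundary functions satisfy Cf − f = \hat{f}(0) − conj(C(conj f)) a.e. on T, where \hat{f}(0) = ∫_T f dm. -/

import Mathlib

open MeasureTheory Complex Filter Set Metric
open scoped ComplexConjugate

noncomputable section

/-- The circle group `ℝ / 2πℤ`, parametrizing the unit circle `𝕋`. -/
instance fact_two_pi_pos : Fact (0 < 2 * Real.pi) := ⟨by positivity⟩

abbrev Tc : Type := AddCircle (2 * Real.pi)

/-- Normalized Lebesgue measure on the circle. -/
def m : Measure Tc := AddCircle.haarAddCircle

instance : IsProbabilityMeasure m := by unfold m; infer_instance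

/-- The point `e^{iθ}` of the unit circle corresponding to `θ ∈ ℝ/2πℤ`. -/
def bd (θ : Tc) : ℂ := (AddCircle.toCircle θ : ℂ)

/-- The open unit disc. -/
abbrev uDisc : Set ℂ := Metric.ball (0 : ℂ) 1

/-- A function holomorphic on the open unit disc. -/
def HolDisc (f : ℂ → ℂ) : Prop := DifferentiableOn ℂ f uDisc

/-- `F` is the radial (a.e.) boundary function of `f`. -/
def IsBdry (f : ℂ → ℂ) (F : Tc → ℂ) : Prop :=
  ∀ᵐ θ ∂m, Tendsto (fun r : ℝ => f ((r : ℂ) * bd θ)) (nhdsWithin 1 (Set.Iio 1)) (nhds (F θ))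

/-- Membership in the Hardy space `H^p` of the unit disc, `0 < p < ∞`. -/
def MemHp (p : ℝ) (f : ℂ → ℂ) : Prop :=
  HolDisc f ∧ ∃ C : ℝ, ∀ r : ℝ, 0 ≤ r → r < 1 →
    (∫ θ : Tc, ‖f ((r : ℂ) * bd θ)‖ ^ p ∂m) ≤ C

/-- Membership in `H^∞`: bounded holomorphic functions on the disc. -/
def MemHinf (f : ℂ → ℂ) : Prop := HolDisc f ∧ ∃ C : ℝ, ∀ z ∈ uDisc, ‖f z‖ ≤ C

/-- Outer functions on the unit disc. -/
def OuterFn (f : ℂ → ℂ) : Prop :=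
  HolDisc f ∧ ∃ (α : ℂ) (w : Tc → ℝ), ‖α‖ = 1 ∧ (∀ θ, 0 ≤ w θ) ∧
    Integrable (fun θ => Real.log (w θ)) m ∧
    ∀ z ∈ uDisc,
      f z = α * Complex.exp (∫ θ : Tc, ((bd θ + z) / (bd θ - z)) * (Real.log (w θ) : ℂ) ∂m)

/-- Inner functions: `Θ` holomorphic bounded by one, with unimodular boundary values `Θs`. -/
def InnerFn (Θ : ℂ → ℂ) (Θs : Tc → ℂ) : Prop :=
  HolDisc Θ ∧ (∀ z ∈ uDisc, ‖Θ z‖ ≤ 1) ∧ IsBdry Θ Θs ∧ (∀ᵐ θ ∂m, ‖Θs θ‖ = 1)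

/-- `L²(𝕋, m)`. -/
abbrev L2 : Type := Lp ℂ 2 m

/-- The Hardy space `H²`, viewed inside `L²(𝕋)` as the functions whose negative
Fourier coefficients vanish. -/
def H2 : Set L2 := {F | ∀ n : ℤ, n < 0 → fourierCoeff (F : Tc → ℂ) n = 0}

/-- The Cauchy kernel `k_λ(z) = 1/(1 - conj(λ) z)`. -/
def ker (lam z : ℂ) : ℂ := (1 - conj lam * z)⁻¹

/-- Divergence of `Σ (1 - |λ_n|)` (for `λ_n` in the unit disc this is the negation of
the Blaschke condition). -/
def NotBlaschke (lam : ℕ → ℂ) : Prop := ¬ Summable (fun n => 1 - ‖lam n‖)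

/-- A bundle recording: a non-constant function `b` in the closed unit ball of `H^∞`
with `log(1 - |b|) ∈ L¹(𝕋)`, its Pythagorean mate `a` (outer, `a(0) > 0`,
`|a|² + |b|² = 1` a.e.), together with their boundary functions `bs`, `as'`. -/
structure BPair where
  b : ℂ → ℂ
  a : ℂ → ℂ
  bs : Tc → ℂ
  as' : Tc → ℂ
  b_hol : HolDisc b
  b_le_one : ∀ z ∈ uDisc, ‖b z‖ ≤ 1
  b_nonconst : ¬ ∃ c : ℂ, ∀ z ∈ uDisc, b z = c
  b_bdry : IsBdry b bs
  log_int : Integrable (fun θ => Real.log (1 - ‖bs θ‖)) m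
  a_outer : OuterFn a
  a_bdry : IsBdry a as'
  a0_pos : ∃ r : ℝ, 0 < r ∧ a 0 = (r : ℂ)
  pyth : ∀ᵐ θ ∂m, ‖as' θ‖ ^ 2 + ‖bs θ‖ ^ 2 = 1

/-- The defining relation of `H(b)`: `T_{conj b} F = T_{conj a} F⁺`, i.e. all nonnegative
Fourier coefficients of `conj(b)·F - conj(a)·F⁺` vanish, with `F, F⁺ ∈ H²`. -/
def HbMem (P : BPair) (F Fp : L2) : Prop :=
  F ∈ H2 ∧ Fp ∈ H2 ∧ ∀ n : ℤ, 0 ≤ n →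
    fourierCoeff (fun θ => conj (P.bs θ) * (F : Tc → ℂ) θ - conj (P.as' θ) * (Fp : Tc → ℂ) θ) n = 0

/-- The ambient Hilbert space `L² ×_2 L²` in which `H(b)` embeds isometrically via
`f ↦ (f, f⁺)`; its norm is `‖(F, F⁺)‖² = ‖F‖₂² + ‖F⁺‖₂²`, the `H(b)` norm. -/
abbrev HbP : Type := WithLp 2 (L2 × L2)

def fst2 (p : HbP) : L2 := ((WithLp.equiv 2 (L2 × L2)) p).1
def snd2 (p : HbP) : L2 := ((WithLp.equiv 2 (L2 × L2)) p).2

/-- The de Branges–Rovnyak space `H(b)`, as the set of pairs `(f, f⁺)`. -/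
def HbSet (P : BPair) : Set HbP := {p | HbMem P (fst2 p) (snd2 p)}

/-- `q` represents the element `φ · f` of `H(b)`, where `p` represents `f` and `φs` is a
boundary function: `q ∈ H(b)` and the first component of `q` is `φs` times that of `p`. -/
def MulRep (P : BPair) (φs : Tc → ℂ) (p q : HbP) : Prop :=
  q ∈ HbSet P ∧ (fst2 q : Tc → ℂ) =ᵐ[m] fun θ => φs θ * (fst2 p : Tc → ℂ) θ

/-- `Zf` is the family of elements `z^n·f`, `n ≥ 0`, of `H(b)`, where `p` represents `f`. -/
def ZFamily (P : BPair) (p : HbP) (Zf : ℕ → HbP) : Prop :=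
  ∀ n : ℕ, MulRep P (fun θ => (bd θ) ^ n) p (Zf n)

/-- `f` (represented by the pair `p`) is cyclic for `S_b`: the linear span of
`{z^n f : n ≥ 0}` is dense in `H(b)`. -/
def CyclicSb (P : BPair) (p : HbP) : Prop :=
  p ∈ HbSet P ∧ ∀ Zf : ℕ → HbP, ZFamily P p Zf →
    closure (↑(Submodule.span ℂ (Set.range Zf)) : Set HbP) = HbSet P

/-- `FK` is the family of elements `f·k_{λ_n}`, `n ≥ 0`, of `H(b)`. -/
def KFamily (P : BPair) (lam : ℕ → ℂ) (p : HbP) (FK : ℕ → HbP) : Prop :=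
  ∀ n : ℕ, MulRep P (fun θ => ker (lam n) (bd θ)) p (FK n)

/-- `C` is a bound for the norm of the shift `S_b` on `H(b)`. -/
def ShiftBound (P : BPair) (C : ℝ) : Prop :=
  0 ≤ C ∧ ∀ p q : HbP, p ∈ HbSet P → MulRep P (fun θ => bd θ) p q → ‖q‖ ≤ C * ‖p‖

/-- `N = ‖S_b‖`, the operator norm of the shift on `H(b)`. -/
def IsShiftNorm (P : BPair) (N : ℝ) : Prop :=
  ShiftBound P N ∧ ∀ C : ℝ, ShiftBound P C → N ≤ C

/-- `μ` is the Aleksandrov–Clark measure `μ_α` of `b`. -/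
def IsACMeasure (P : BPair) (α : ℂ) (μ : Measure Tc) : Prop :=
  IsFiniteMeasure μ ∧ ∀ z ∈ uDisc,
    (1 - ‖P.b z‖ ^ 2) / ‖1 - conj α * P.b z‖ ^ 2 = ∫ θ : Tc, (1 - ‖z‖ ^ 2) / ‖z - bd θ‖ ^ 2 ∂μ


/-- The Cauchy transform of `f ∈ L¹(𝕋)`, as a function on the unit disc. -/
def cauchyT (f : Tc → ℂ) (z : ℂ) : ℂ := ∫ θ : Tc, f θ / (1 - conj (bd θ) * z) ∂m

/-- The Poisson kernel, written through the Cauchy kernel. -/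
def pK (r : ℝ) (a b : Tc) : ℂ :=
  (1 - conj (bd a) * ((r : ℂ) * bd b))⁻¹ + conj ((1 - conj (bd a) * ((r : ℂ) * bd b))⁻¹) - 1

/-- The Poisson integral. -/
def pI (r : ℝ) (f : Tc → ℂ) (b : Tc) : ℂ := ∫ a : Tc, f a * pK r a b ∂m

lemma norm_bd (a : Tc) : ‖bd a‖ = 1 := Circle.norm_coe _

lemma continuous_bd : Continuous bd := by
  unfold bd
  exact continuous_subtype_val.comp AddCircle.continuous_toCircle

lemma norm_w (r : ℝ) (hr : 0 ≤ r) (a b : Tc) : ‖conj (bd a) * ((r : ℂ) * bd b)‖ = r := by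
  simp [norm_bd, abs_of_nonneg hr]

lemma one_sub_ne {w : ℂ} (hw : ‖w‖ < 1) : 1 - w ≠ 0 := by
  intro h
  have : w = 1 := (sub_eq_zero.mp h).symm
  simp [this] at hw

lemma fourier_bd_pow_pos (k : ℕ) (a : Tc) : bd a ^ k = fourier (k : ℤ) a := by
  rw [bd, fourier_apply, natCast_zsmul, AddCircle.toCircle_nsmul]
  rfl

lemma fourier_bd_pow (k : ℕ) (a : Tc) : conj (bd a) ^ k = fourier (-(k : ℤ)) a := by
  rw [fourier_neg, ← map_pow]
  rw [fourier_bd_pow_pos]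

lemma integral_fourier_m (n : ℤ) : ∫ a : Tc, fourier n a ∂m = if n = 0 then 1 else 0 := by
  split_ifs with h
  · subst h; simp
  · exact integral_eq_zero_of_add_right_eq_neg (μ := AddCircle.haarAddCircle)
      (fourier_add_half_inv_index h fact_two_pi_pos.out)

lemma moment (c : ℂ) (hc : ‖c‖ < 1) (n : ℤ) :
    ∫ a : Tc, fourier n a * (1 - conj (bd a) * c)⁻¹ ∂m = if 0 ≤ n then c ^ n.toNat else 0 := by
  have h1 : ∀ a : Tc, fourier n a * (1 - conj (bd a) * c)⁻¹
      = ∑' k : ℕ, c ^ k * fourier (n - k) a := by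
    intro a
    have hw : ‖conj (bd a) * c‖ < 1 := by simpa [norm_bd] using hc
    rw [← tsum_geometric_of_norm_lt_one hw, ← tsum_mul_left]
    congr 1
    ext k
    rw [mul_pow, fourier_bd_pow, sub_eq_add_neg, fourier_add]
    ring
  simp_rw [h1]
  have hn : ∀ k : ℕ, ∀ a : Tc, ‖c ^ k * fourier (n - k) a‖ = ‖c‖ ^ k := by
    intro k a
    rw [norm_mul, norm_pow, fourier_apply, Circle.norm_coe, mul_one]
  have h2 : ∀ k : ℕ, Integrable (fun a : Tc => c ^ k * fourier (n - k) a) m := by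
    intro k
    refine Continuous.integrable_of_hasCompactSupport (by fun_prop) ?_
    exact HasCompactSupport.of_compactSpace _
  have h3 := hasSum_integral_of_summable_integral_norm h2 (by
    simp_rw [hn]
    simpa using summable_geometric_of_lt_one (norm_nonneg c) hc)
  have h4 : ∀ k : ℕ, ∫ a : Tc, c ^ k * fourier (n - k) a ∂m
      = if n = k then c ^ k else 0 := by
    intro k
    rw [integral_const_mul, integral_fourier_m]
    simp [sub_eq_zero]
  simp_rw [h4] at h3
  refine h3.unique ?_
  split_ifs with h
  · obtain ⟨k, rfl⟩ := Int.eq_ofNat_of_zero_le h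
    have he : (fun x : ℕ => if (k : ℤ) = (x : ℤ) then c ^ x else 0)
        = fun x => if x = k then c ^ k else 0 := by
      ext j
      by_cases hj : j = k
      · simp [hj]
      · rw [if_neg hj, if_neg]
        omega
    change HasSum (fun x : ℕ => if (k : ℤ) = (x : ℤ) then c ^ x else 0) (c ^ k)
    rw [he]
    exact hasSum_ite_eq k (c ^ k)
  · convert hasSum_zero with k
    rw [if_neg]
    omega

lemma pK_real (r : ℝ) (hr : 0 ≤ r) (hr1 : r < 1) (a b : Tc) :
    pK r a b = (((1 - r ^ 2) / ‖1 - conj (bd a) * ((r : ℂ) * bd b)‖ ^ 2 : ℝ) : ℂ) := by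
  unfold pK
  have hw := norm_w r hr a b
  set w := conj (bd a) * ((r : ℂ) * bd b)
  have h1 : 1 - w ≠ 0 := one_sub_ne (by rw [hw]; exact hr1)
  have h2 : conj (1 - w) ≠ 0 := (map_ne_zero _).mpr h1
  have h3 : ((‖1 - w‖ : ℂ)) ^ 2 = (1 - w) * conj (1 - w) := by
    rw [Complex.mul_conj, Complex.normSq_eq_norm_sq]; push_cast; rfl
  have h4 : (r : ℂ) ^ 2 = w * conj w := by
    rw [Complex.mul_conj, Complex.normSq_eq_norm_sq, hw]; push_cast; rfl
  push_cast
  rw [h3, h4, map_inv₀]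
  field_simp
  simp only [map_sub, map_one]
  ring

lemma pK_symm (r : ℝ) (hr : 0 ≤ r) (hr1 : r < 1) (a b : Tc) : pK r a b = pK r b a := by
  rw [pK_real r hr hr1, pK_real r hr hr1]
  congr 3
  rw [← Complex.norm_conj]
  congr 1
  simp only [map_sub, map_one, map_mul, Complex.conj_conj, Complex.conj_ofReal]
  ring

lemma continuous_pK (r : ℝ) (hr : 0 ≤ r) (hr1 : r < 1) :
    Continuous (fun p : Tc × Tc => pK r p.1 p.2) := by
  have hc : Continuous (fun p : Tc × Tc => (1 - conj (bd p.1) * ((r : ℂ) * bd p.2))⁻¹) := by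
    refine Continuous.inv₀ ?_ ?_
    · have := continuous_bd
      fun_prop
    · intro p
      exact one_sub_ne (by rw [norm_w r hr]; exact hr1)
  unfold pK
  fun_prop

lemma continuous_pK_right (r : ℝ) (hr : 0 ≤ r) (hr1 : r < 1) (a : Tc) :
    Continuous (fun b : Tc => pK r a b) := by
  have h : Continuous fun b : Tc => ((a, b) : Tc × Tc) := by fun_prop
  have h2 := Continuous.comp (continuous_pK r hr hr1) h
  exact h2

lemma continuous_pK_left (r : ℝ) (hr : 0 ≤ r) (hr1 : r < 1) (b : Tc) :
    Continuous (fun a : Tc => pK r a b) := by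
  have h : Continuous fun a : Tc => ((a, b) : Tc × Tc) := by fun_prop
  have h2 := Continuous.comp (continuous_pK r hr hr1) h
  exact h2

lemma integrable_cont {g : Tc → ℂ} (hg : Continuous g) : Integrable g m :=
  hg.integrable_of_hasCompactSupport (HasCompactSupport.of_compactSpace _)

lemma integrable_mul_cont {f g : Tc → ℂ} (hf : Integrable f m) (hg : Continuous g) :
    Integrable (fun a => f a * g a) m := by
  obtain ⟨C, hC⟩ := isCompact_univ.exists_bound_of_continuousOn hg.continuousOn
  exact hf.mul_bdd (c := C) hg.aestronglyMeasurable (ae_of_all _ fun a => hC a (mem_univ a))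

lemma continuous_ck (c : ℂ) (hc : ‖c‖ < 1) :
    Continuous (fun a : Tc => (1 - conj (bd a) * c)⁻¹) := by
  refine Continuous.inv₀ ?_ ?_
  · have := continuous_bd
    fun_prop
  · intro p
    exact one_sub_ne (by simpa [norm_bd] using hc)

lemma pI_split (r : ℝ) (hr : 0 ≤ r) (hr1 : r < 1) (f : Tc → ℂ) (hf : Integrable f m) (b : Tc) :
    pI r f b = cauchyT f ((r : ℂ) * bd b)
      + conj (cauchyT (fun a => conj (f a)) ((r : ℂ) * bd b)) - ∫ a, f a ∂m := by
  unfold pI cauchyT pK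
  have hc : ‖(r : ℂ) * bd b‖ < 1 := by simpa [norm_bd, abs_of_nonneg hr] using hr1
  have hk := continuous_ck _ hc
  rw [← integral_conj, ← integral_add, ← integral_sub _ hf]
  · congr 1
    ext a
    simp only [Complex.conj_conj, div_eq_mul_inv, map_mul, map_inv₀]
    ring
  · refine Integrable.add ?_ ?_
    · simpa only [div_eq_mul_inv] using integrable_mul_cont hf hk
    · have := integrable_mul_cont hf (Complex.continuous_conj.comp hk)
      simpa [div_eq_mul_inv] using this
  · simpa only [div_eq_mul_inv] using integrable_mul_cont hf hk
  · have := integrable_mul_cont hf (Complex.continuous_conj.comp hk)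
    simpa [div_eq_mul_inv] using this

lemma pI_fourier (r : ℝ) (hr : 0 ≤ r) (hr1 : r < 1) (n : ℤ) (b : Tc) :
    pI r (fourier n) b = (r : ℂ) ^ n.natAbs * fourier n b := by
  have hc : ‖(r : ℂ) * bd b‖ < 1 := by simpa [norm_bd, abs_of_nonneg hr] using hr1
  rw [pI_split r hr hr1 _ (integrable_cont (by fun_prop))]
  unfold cauchyT
  simp_rw [← fourier_neg, div_eq_mul_inv]
  rw [moment _ hc, moment _ hc, integral_fourier_m]
  rcases lt_trichotomy n 0 with h | h | h
  · obtain ⟨k, rfl⟩ : ∃ k : ℕ, n = -(k : ℤ) := ⟨n.natAbs, by omega⟩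
    rw [if_neg (by omega), if_pos (by omega), if_neg (by omega)]
    simp only [neg_neg, Int.toNat_natCast, Int.natAbs_neg, Int.natAbs_natCast, map_pow, map_mul,
      Complex.conj_ofReal, mul_pow, fourier_bd_pow]
    ring
  · subst h; simp
  · obtain ⟨k, rfl⟩ : ∃ k : ℕ, n = (k : ℤ) := ⟨n.natAbs, by omega⟩
    rw [if_pos (by omega), if_neg (by omega), if_neg (by omega)]
    simp only [Int.toNat_natCast, Int.natAbs_natCast, mul_pow, fourier_bd_pow_pos]
    simp

lemma lintegral_pK (r : ℝ) (hr : 0 ≤ r) (hr1 : r < 1) (a : Tc) :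
    ∫⁻ b : Tc, ‖pK r a b‖ₑ ∂m = 1 := by
  have h0 : pI r (fourier 0) a = 1 := by rw [pI_fourier r hr hr1]; simp
  have hcont : Continuous (fun b => pK r a b) :=
    continuous_pK_right r hr hr1 a
  have h1 : ∫ b : Tc, pK r a b ∂m = 1 := by
    rw [← h0]
    unfold pI
    congr 1
    ext b
    rw [pK_symm r hr hr1]; simp
  have h2 : ∀ b, pK r a b = ((‖pK r a b‖ : ℝ) : ℂ) := by
    intro b
    rw [pK_real r hr hr1, Complex.norm_real, Real.norm_of_nonneg]
    have : 0 ≤ 1 - r ^ 2 := by nlinarith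
    positivity
  have h3 : ∫ b : Tc, ‖pK r a b‖ ∂m = 1 := by
    have : ∫ b : Tc, ((‖pK r a b‖ : ℝ) : ℂ) ∂m = 1 := by
      rw [← h1]; congr 1; ext b; exact (h2 b).symm
    rw [integral_complex_ofReal] at this
    exact_mod_cast this
  rw [← ofReal_integral_norm_eq_lintegral_enorm (integrable_cont hcont), h3]
  simp

lemma aesm_pK (r : ℝ) (hr : 0 ≤ r) (hr1 : r < 1) (f : Tc → ℂ) (hf : Integrable f m) :
    AEStronglyMeasurable (fun p : Tc × Tc => f p.2 * pK r p.2 p.1) (m.prod m) :=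
  (hf.aestronglyMeasurable.comp_snd).mul
    ((continuous_pK r hr hr1).comp continuous_swap).aestronglyMeasurable

lemma aesm_pI (r : ℝ) (hr : 0 ≤ r) (hr1 : r < 1) (f : Tc → ℂ) (hf : Integrable f m) :
    AEStronglyMeasurable (pI r f) m :=
  (aesm_pK r hr hr1 f hf).integral_prod_right'

lemma pI_contr (r : ℝ) (hr : 0 ≤ r) (hr1 : r < 1) (f : Tc → ℂ) (hf : Integrable f m) :
    ∫⁻ b, ‖pI r f b‖ₑ ∂m ≤ ∫⁻ a, ‖f a‖ₑ ∂m := by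
  calc ∫⁻ b, ‖pI r f b‖ₑ ∂m ≤ ∫⁻ b, ∫⁻ a, ‖f a * pK r a b‖ₑ ∂m ∂m :=
        lintegral_mono fun b => enorm_integral_le_lintegral_enorm _
    _ = ∫⁻ a, ∫⁻ b, ‖f a * pK r a b‖ₑ ∂m ∂m :=
        lintegral_lintegral_swap (aesm_pK r hr hr1 f hf).enorm
    _ = ∫⁻ a, ‖f a‖ₑ ∂m := by
        refine lintegral_congr fun a => ?_
        simp_rw [enorm_mul]
        rw [lintegral_const_mul' _ _ (by simp), lintegral_pK r hr hr1, mul_one]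

/-- The Poisson integral of a difference. -/
lemma pI_sub (r : ℝ) (hr : 0 ≤ r) (hr1 : r < 1) (f g : Tc → ℂ) (hf : Integrable f m)
    (hg : Integrable g m) (b : Tc) : pI r (fun a => f a - g a) b = pI r f b - pI r g b := by
  have hcont : Continuous (fun a => pK r a b) :=
    continuous_pK_left r hr hr1 b
  unfold pI
  rw [← integral_sub (integrable_mul_cont hf hcont) (integrable_mul_cont hg hcont)]
  simp_rw [sub_mul]

lemma pI_add (r : ℝ) (hr : 0 ≤ r) (hr1 : r < 1) (f g : Tc → ℂ) (hf : Integrable f m)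
    (hg : Integrable g m) (b : Tc) : pI r (fun a => f a + g a) b = pI r f b + pI r g b := by
  have hcont : Continuous (fun a => pK r a b) :=
    continuous_pK_left r hr hr1 b
  unfold pI
  rw [← integral_add (integrable_mul_cont hf hcont) (integrable_mul_cont hg hcont)]
  simp_rw [add_mul]

lemma ev_r : ∀ᶠ r : ℝ in nhdsWithin 1 (Set.Iio 1), 0 ≤ r ∧ r < 1 := by
  filter_upwards [self_mem_nhdsWithin,
    mem_nhdsWithin_of_mem_nhds (Ioi_mem_nhds (zero_lt_one : (0 : ℝ) < 1))] with r h1 h2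
  exact ⟨le_of_lt h2, h1⟩

lemma pI_trig (h : C(Tc, ℂ)) (hh : h ∈ Submodule.span ℂ (Set.range (@fourier (2 * Real.pi))))
    (b : Tc) : Tendsto (fun r : ℝ => pI r h b) (nhdsWithin 1 (Set.Iio 1)) (nhds (h b)) := by
  induction hh using Submodule.span_induction with
  | mem x hx =>
    obtain ⟨n, rfl⟩ := hx
    have : Tendsto (fun r : ℝ => (r : ℂ) ^ n.natAbs * fourier n b) (nhdsWithin 1 (Set.Iio 1))
        (nhds (fourier n b)) := by
      have hc : Continuous (fun r : ℝ => (r : ℂ) ^ n.natAbs * fourier n b) := by fun_prop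
      have := (hc.tendsto 1).mono_left (nhdsWithin_le_nhds (s := Set.Iio 1))
      simpa using this
    refine this.congr' ?_
    filter_upwards [ev_r] with r hr
    exact (pI_fourier r hr.1 hr.2 n b).symm
  | zero => simp [pI]
  | add x y _ _ hx hy =>
    refine (hx.add hy).congr' ?_
    filter_upwards [ev_r] with r hr
    exact (pI_add r hr.1 hr.2 x y (integrable_cont x.continuous) (integrable_cont y.continuous)
      b).symm
  | smul c x _ hx =>
    refine (hx.const_mul c).congr' ?_
    filter_upwards [ev_r] with r hr
    unfold pI
    rw [← integral_const_mul]
    simp [mul_assoc]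

lemma approx_trig (f : Tc → ℂ) (hf : Integrable f m) (ε : ℝ) (hε : 0 < ε) :
    ∃ h : C(Tc, ℂ), h ∈ Submodule.span ℂ (Set.range (@fourier (2 * Real.pi))) ∧
      ∫⁻ a, ‖f a - h a‖ₑ ∂m ≤ ENNReal.ofReal ε := by
  have : m.Regular := by unfold m; infer_instance
  obtain ⟨g, -, hg, hgc, -⟩ := hf.exists_hasCompactSupport_lintegral_sub_le
    (ε := ENNReal.ofReal (ε / 2)) (by simpa using hε)
  have hmem : (⟨g, hgc⟩ : C(Tc, ℂ)) ∈ closure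
      (Submodule.span ℂ (Set.range (@fourier (2 * Real.pi))) : Set C(Tc, ℂ)) := by
    rw [← Submodule.topologicalClosure_coe, span_fourier_closure_eq_top]
    trivial
  obtain ⟨h, hh, hd⟩ := Metric.mem_closure_iff.mp hmem (ε / 2) (by positivity)
  refine ⟨h, hh, ?_⟩
  calc ∫⁻ a, ‖f a - h a‖ₑ ∂m ≤ ∫⁻ a, (‖f a - g a‖ₑ + ENNReal.ofReal (ε / 2)) ∂m := by
        refine lintegral_mono fun a => ?_
        have h1 : ‖g a - h a‖ₑ ≤ ENNReal.ofReal (ε / 2) := by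
          rw [← ofReal_norm, ← dist_eq_norm]
          exact ENNReal.ofReal_le_ofReal
            ((ContinuousMap.dist_apply_le_dist (f := ⟨g, hgc⟩) (g := h) a).trans hd.le)
        calc ‖f a - h a‖ₑ = ‖(f a - g a) + (g a - h a)‖ₑ := by congr 1; ring
          _ ≤ _ := (enorm_add_le _ _).trans (by gcongr)
    _ ≤ ENNReal.ofReal (ε / 2) + ENNReal.ofReal (ε / 2) := by
        rw [lintegral_add_right _ measurable_const]
        gcongr
        simp
    _ = ENNReal.ofReal ε := by
        rw [← ENNReal.ofReal_add (by positivity) (by positivity)]; simp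

/-- If the Poisson integrals of `f` converge radially a.e., then the limit is `f` a.e. -/
lemma pI_limit (f G : Tc → ℂ) (hf : Integrable f m)
    (hG : ∀ᵐ b ∂m, Tendsto (fun r : ℝ => pI r f b) (nhdsWithin 1 (Set.Iio 1)) (nhds (G b))) :
    ∀ᵐ b ∂m, G b = f b := by
  obtain ⟨u, -, hu, hu1⟩ := exists_seq_strictMono_tendsto' (zero_lt_one : (0 : ℝ) < 1)
  have hul : Tendsto u atTop (nhdsWithin 1 (Set.Iio 1)) :=
    tendsto_nhdsWithin_iff.mpr ⟨hu1, Eventually.of_forall fun n => (hu n).2⟩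
  have hGm : AEStronglyMeasurable G m :=
    aestronglyMeasurable_of_tendsto_ae atTop
      (fun n => aesm_pI (u n) (hu n).1.le (hu n).2 f hf)
      (hG.mono fun b hb => hb.comp hul)
  have key : ∀ ε : ℝ, 0 < ε → ∫⁻ b, ‖G b - f b‖ₑ ∂m ≤ ENNReal.ofReal ε := by
    intro ε hε
    obtain ⟨h, hh, hfh⟩ := approx_trig f hf (ε / 2) (by positivity)
    have hhi : Integrable h m := integrable_cont h.continuous
    have hGh : ∫⁻ b, ‖G b - h b‖ₑ ∂m ≤ ENNReal.ofReal (ε / 2) := by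
      calc ∫⁻ b, ‖G b - h b‖ₑ ∂m
          = ∫⁻ b, liminf (fun n => ‖pI (u n) (fun a => f a - h a) b‖ₑ) atTop ∂m := by
            refine lintegral_congr_ae ?_
            filter_upwards [hG] with b hb
            refine (Tendsto.liminf_eq ?_).symm
            refine Tendsto.enorm ?_
            refine ((hb.comp hul).sub ((pI_trig h hh b).comp hul)).congr fun n => ?_
            exact (pI_sub (u n) (hu n).1.le (hu n).2 f h hf hhi b).symm
        _ ≤ liminf (fun n => ∫⁻ b, ‖pI (u n) (fun a => f a - h a) b‖ₑ ∂m) atTop :=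
            lintegral_liminf_le' fun n =>
              (aesm_pI (u n) (hu n).1.le (hu n).2 _ (hf.sub hhi)).enorm
        _ ≤ liminf (fun _ : ℕ => ENNReal.ofReal (ε / 2)) atTop := by
            refine liminf_le_liminf (Eventually.of_forall fun n => ?_)
            exact (pI_contr (u n) (hu n).1.le (hu n).2 _ (hf.sub hhi)).trans hfh
        _ = ENNReal.ofReal (ε / 2) := by simp
    calc ∫⁻ b, ‖G b - f b‖ₑ ∂m ≤ ∫⁻ b, (‖G b - h b‖ₑ + ‖f b - h b‖ₑ) ∂m := by
          refine lintegral_mono fun b => ?_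
          calc ‖G b - f b‖ₑ = ‖(G b - h b) - (f b - h b)‖ₑ := by congr 1; ring
            _ ≤ _ := enorm_sub_le
      _ = ∫⁻ b, ‖G b - h b‖ₑ ∂m + ∫⁻ b, ‖f b - h b‖ₑ ∂m :=
          lintegral_add_right' _ (hf.sub hhi).aestronglyMeasurable.enorm
      _ ≤ ENNReal.ofReal (ε / 2) + ENNReal.ofReal (ε / 2) := by gcongr
      _ = ENNReal.ofReal ε := by
          rw [← ENNReal.ofReal_add (by positivity) (by positivity)]; simp
  have h0 : ∫⁻ b, ‖G b - f b‖ₑ ∂m = 0 := by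
    refine le_antisymm ?_ bot_le
    have ht : Tendsto (fun ε : ℝ => ENNReal.ofReal ε) (nhdsWithin 0 (Set.Ioi 0)) (nhds 0) := by
      have := (ENNReal.continuous_ofReal.tendsto 0).mono_left
        (nhdsWithin_le_nhds (s := Set.Ioi 0))
      simpa using this
    refine ge_of_tendsto ht ?_
    filter_upwards [self_mem_nhdsWithin] with ε hε using key ε hε
  have h00 := (lintegral_eq_zero_iff' (hGm.sub hf.aestronglyMeasurable).enorm).mp h0
  filter_upwards [h00] with b hb
  simpa [sub_eq_zero] using hb

/-- For every `f ∈ L¹(𝕋)`, the boundary functions satisfy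
`Cf - f = f̂(0) - conj(C(conj f))` a.e. on `𝕋`, where `f̂(0) = ∫ f dm`. -/
theorem stmt_2 (f : Tc → ℂ) (hf : Integrable f m)
    (Cfs Ccfs : Tc → ℂ)
    (h1 : IsBdry (cauchyT f) Cfs)
    (h2 : IsBdry (cauchyT (fun θ => conj (f θ))) Ccfs) :
    ∀ᵐ θ ∂m, Cfs θ - f θ = (∫ θ' : Tc, f θ' ∂m) - conj (Ccfs θ) := by
  have hlim := pI_limit f (fun b => Cfs b + conj (Ccfs b) - ∫ a, f a ∂m) hf (by
    filter_upwards [h1, h2] with b hb1 hb2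
    have hb3 := (Complex.continuous_conj.tendsto _).comp hb2
    refine ((hb1.add hb3).sub_const _).congr' ?_
    filter_upwards [ev_r] with r hr
    exact (pI_split r hr.1 hr.2 f hf b).symm)
  filter_upwards [hlim] with b hb
  rw [← hb]
  ring

end
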